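/- arXiv:2011.10083 — 2 statements merged into one kernel-verified Lean document; each statement's English description precedes it below -/
import Mathlib

section
/- Let m, n_1, …, n_m be natural numbers, p_1, …, p_m distinct prime numbers, and let (X,·) be a uniconnected cycle set of cardinality p_1^{n_1}⋯p_m^{n_m} whose permutation group 𝒢(X) is nilpotent. Then there exist m indecomposable cycle sets (Y_1,·_1), …, (Y_m,·_m) with |Y_i| = p_i^{n_i} for each i such that (X,·) is isomorphic (as a cycle set) to the direct product Y_1 × ⋯ × Y_m with componentwise operation. -/
structure CycleSet (X : Type*) where
  mul : X → X → X
  mul_bijective : ∀ x, Function.Bijective (mul x)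
  cycloid : ∀ x y z, mul (mul x y) (mul x z) = mul (mul y x) (mul y z)
  nondeg : Function.Bijective (fun x => mul x x)

namespace CycleSet

variable {X : Type*}

/-- The left multiplication `σ_x` as a permutation of `X`. -/
noncomputable def sigma (C : CycleSet X) (x : X) : Equiv.Perm X :=
  Equiv.ofBijective (C.mul x) (C.mul_bijective x)

/-- The permutation group `𝒢(X)` of a cycle set. -/
noncomputable def G (C : CycleSet X) : Subgroup (Equiv.Perm X) :=
  Subgroup.closure (Set.range C.sigma)

/-- A cycle set is indecomposable if `𝒢(X)` acts transitively on `X`. -/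
def Indecomposable (C : CycleSet X) : Prop := ∀ x y : X, ∃ g ∈ C.G, g x = y

/-- A cycle set is uniconnected if `𝒢(X)` acts regularly on `X`. -/
def Uniconnected (C : CycleSet X) : Prop :=
  ∀ x y : X, ∃! g : Equiv.Perm X, g ∈ C.G ∧ g x = y

/-- `MPLrel C n a b` holds iff `a`, `b` have the same image in the `n`-th iterated
retraction `Ret^n(X)`. -/
def MPLrel (C : CycleSet X) : ℕ → X → X → Prop
  | 0 => Eq
  | n + 1 => fun a b => ∀ z, MPLrel C n (C.mul a z) (C.mul b z)

/-- A cycle set has multipermutation level `n` if `n` is minimal with `|Ret^n(X)| = 1`. -/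
def MPL (C : CycleSet X) (n : ℕ) : Prop :=
  (∀ a b, MPLrel C n a b) ∧ ∀ m < n, ∃ a b, ¬ MPLrel C m a b

end CycleSet

/-- `𝒜` is the system of blocks generated by a block `B` for the subgroup `G` of `Sym(Z)`. -/
def IsBlockSystem {Z : Type*} (G : Subgroup (Equiv.Perm Z)) (𝒜 : Set (Set Z)) : Prop :=
  ∃ B : Set Z, B.Nonempty ∧
    (∀ g ∈ G, (⇑g) '' B = B ∨ Disjoint ((⇑g) '' B) B) ∧
    𝒜 = {A | ∃ g ∈ G, A = (⇑g) '' B}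

/-- Two systems of blocks are orthogonal if any two members meet in exactly one point. -/
def OrthSystems {Z : Type*} (𝒜 ℬ : Set (Set Z)) : Prop :=
  ∀ A ∈ 𝒜, ∀ B ∈ ℬ, ∃ z, A ∩ B = {z}

/-- The system of blocks `𝓑_X = {{x} × S : x ∈ X}` on `X × S`. -/
def BXblocks (X S : Type*) : Set (Set (X × S)) :=
  {B | ∃ x : X, B = {p : X × S | p.1 = x}}

/-- The system of blocks `{X × {s} : s ∈ S}` on `X × S`. -/
def SBlocks (X S : Type*) : Set (Set (X × S)) :=
  {B | ∃ s : S, B = {p : X × S | p.2 = s}}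

/-- The system of blocks formed by the classes of the retract relation. -/
def RetBlocks {X : Type*} (C : CycleSet X) : Set (Set X) :=
  {B | ∃ x : X, B = {y : X | ∀ z, C.mul y z = C.mul x z}}

/-- In a finite nilpotent group, elements of coprime orders commute. -/
theorem commute_of_coprime_orders {G : Type*} [Group G] [Finite G] (hnil : Group.IsNilpotent G)
    (a b : G) (h : (orderOf a).Coprime (orderOf b)) : a * b = b * a := by
  obtain ⟨e'⟩ := (Group.isNilpotent_of_finite_tfae (G := G)).out 0 4 |>.mp hnil
  let e := e'.symm
  apply e.injective
  rw [map_mul, map_mul]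
  funext q P
  rw [Pi.mul_apply, Pi.mul_apply, Pi.mul_apply, Pi.mul_apply]
  have hq : Fact (q : ℕ).Prime := ⟨Nat.prime_of_mem_primeFactors q.2⟩
  let π : G →* (P : Subgroup G) :=
    ((Pi.evalMonoidHom _ P).comp (Pi.evalMonoidHom _ q)).comp e.toMonoidHom
  change π a * π b = π b * π a
  obtain ⟨i, hi⟩ := (IsPGroup.iff_orderOf.mp P.isPGroup') (π a)
  obtain ⟨j, hj⟩ := (IsPGroup.iff_orderOf.mp P.isPGroup') (π b)
  have hc : (orderOf (π a)).Coprime (orderOf (π b)) :=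
    Nat.Coprime.coprime_dvd_left (orderOf_map_dvd π a)
      (Nat.Coprime.coprime_dvd_right (orderOf_map_dvd π b) h)
  rcases Nat.eq_zero_or_pos i with h0 | h0
  · subst h0
    rw [pow_zero, orderOf_eq_one_iff] at hi
    rw [hi]; simp
  rcases Nat.eq_zero_or_pos j with h1 | h1
  · subst h1
    rw [pow_zero, orderOf_eq_one_iff] at hj
    rw [hj]; simp
  exfalso
  rw [hi, hj] at hc
  exact Nat.not_coprime_of_dvd_of_dvd hq.out.one_lt (dvd_pow_self _ h0.ne')
    (dvd_pow_self _ h1.ne') hc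

section Brace

variable {G : Type*} [Group G] [AddCommGroup G]

/-- The multiplicative subgroup of elements killed additively by `k`. -/
def torsSub (act : G → G →+ G) (hadd : ∀ g h, g + h = act g h * g)
    (h1 : ∀ g, act 1 g = g) (hmul : ∀ g h x, act (g * h) x = act g (act h x)) (k : ℕ) :
    Subgroup G where
  carrier := {g | k • g = 0}
  one_mem' := by
    have := hadd 1 0
    rw [h1, mul_one, add_zero] at this
    simp [this]
  mul_mem' := by
    intro a b ha hb
    have : a * b = b + act b⁻¹ a := by
      rw [hadd, ← hmul, mul_inv_cancel, h1]
    simp only [Set.mem_ofPred_eq] at *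
    rw [this, nsmul_add, hb, ← map_nsmul, ha, map_zero, add_zero]
  inv_mem' := by
    intro a ha
    have h01 : (1 : G) = 0 := by
      have := hadd 1 0
      rwa [h1, mul_one, add_zero] at this
    have h2 : a + act a⁻¹ a⁻¹ = 0 := by
      rw [hadd, ← hmul, mul_inv_cancel, h1, inv_mul_cancel, h01]
    have h3 : a⁻¹ = act a (-a) := by
      rw [← eq_neg_of_add_eq_zero_right h2, ← hmul, mul_inv_cancel, h1]
    simp only [Set.mem_ofPred_eq] at *
    rw [h3, ← map_nsmul, neg_nsmul, ha, neg_zero, map_zero]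

theorem brace_pair [Finite G] (hnil : Group.IsNilpotent G)
    (act : G → G →+ G) (hadd : ∀ g h, g + h = act g h * g)
    (h1 : ∀ g, act 1 g = g) (hmul : ∀ g h x, act (g * h) x = act g (act h x))
    (k l : ℕ) (hkl : k.Coprime l) (hcard : Nat.card G = k * l) :
    ∃ H N : Subgroup G, N.Normal ∧ (∀ g, g ∈ N ↔ l • g = 0) ∧
      (∀ h ∈ N, ∀ s, ∃ t ∈ N, act h s = s * t) ∧ Nat.card H ∣ k ∧
      ∀ g, ∃ u ∈ H, ∃ v ∈ N, g = v * u := by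
  have h01 : (1 : G) = 0 := by
    have := hadd 1 0
    rwa [h1, mul_one, add_zero] at this
  let T := torsSub act hadd h1 hmul
  have hT : ∀ k g, g ∈ T k ↔ k • g = 0 := fun k g => Iff.rfl
  have hmulT : ∀ a b, a * b = b + act b⁻¹ a := by
    intro a b
    rw [hadd, ← hmul, mul_inv_cancel, h1]
  have hact : ∀ k g x, x ∈ T k → act g x ∈ T k := by
    intro k g x hx
    rw [hT] at *
    rw [← map_nsmul, hx, map_zero]
  -- primes dividing the card of T k divide k
  have hprime : ∀ k q : ℕ, q.Prime → q ∣ Nat.card (T k) → q ∣ k := by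
    intro k q hq hd
    let S : AddSubgroup G := (nsmulAddMonoidHom (α := G) k).ker
    have hS : ∀ g, g ∈ S ↔ k • g = 0 := fun g => by
      simp [S, AddMonoidHom.mem_ker]
    have hc : Nat.card (T k) = Nat.card S :=
      Nat.card_congr (Equiv.subtypeEquivRight (fun g => by
        exact (hT k g).trans (hS g).symm))
    have : Fact q.Prime := ⟨hq⟩
    obtain ⟨x, hx⟩ := exists_prime_addOrderOf_dvd_card' (G := S) q (hc ▸ hd)
    rw [← hx]
    apply addOrderOf_dvd_of_nsmul_eq_zero
    apply Subtype.ext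
    exact (hS x).mp x.2
  have hcop : (Nat.card (T k)).Coprime (Nat.card (T l)) := by
    apply Nat.coprime_of_dvd
    intro q hq ha hb
    exact Nat.not_coprime_of_dvd_of_dvd hq.one_lt (hprime k q hq ha) (hprime l q hq hb) hkl
  have hcop2 : (Nat.card (T k)).Coprime l := by
    apply Nat.coprime_of_dvd
    intro q hq ha hb
    exact Nat.not_coprime_of_dvd_of_dvd hq.one_lt (hprime k q hq ha) hb hkl
  have hcomm : ∀ u ∈ T k, ∀ v ∈ T l, u * v = v * u := by
    intro u hu v hv
    apply commute_of_coprime_orders hnil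
    exact Nat.Coprime.coprime_dvd_left (Subgroup.orderOf_dvd_natCard _ hu)
      (Nat.Coprime.coprime_dvd_right (Subgroup.orderOf_dvd_natCard _ hv) hcop)
  have hint : ∀ g, g ∈ T k → g ∈ T l → g = 1 := by
    intro g hk hl
    rw [h01]
    have := Nat.dvd_gcd (addOrderOf_dvd_of_nsmul_eq_zero hk) (addOrderOf_dvd_of_nsmul_eq_zero hl)
    rw [hkl, Nat.dvd_one] at this
    exact AddMonoid.addOrderOf_eq_one_iff.mp this
  have htriv : ∀ u ∈ T k, ∀ v ∈ T l, act u v = v ∧ act v u = u := by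
    intro u hu v hv
    have e1 : act u v * u = act v u * v := by
      rw [← hadd, ← hadd, add_comm]
    rw [hcomm _ (hact k v u hu) v hv] at e1
    have e2 : v⁻¹ * act u v = act v u * u⁻¹ := by
      rw [inv_mul_eq_iff_eq_mul, ← mul_assoc, ← e1, mul_inv_cancel_right]
    have e3 : v⁻¹ * act u v = 1 := by
      apply hint
      · rw [e2]; exact mul_mem (hact k v u hu) (inv_mem hu)
      · exact mul_mem (inv_mem hv) (hact l u v hv)
    have e4 := e3
    rw [e2] at e4
    exact ⟨(inv_mul_eq_one.mp e3).symm, mul_inv_eq_one.mp e4⟩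
  have hdec : ∀ g, ∃ u ∈ T k, ∃ v ∈ T l, g = v * u ∧ g = u + v := by
    intro g
    have hb : (1 : ℤ) = k * Nat.gcdA k l + l * Nat.gcdB k l := by
      rw [← Nat.gcd_eq_gcd_ab, hkl]; rfl
    have hn : ((k : ℤ) * l) • g = 0 := by
      have : (k * l) • g = 0 := by rw [← hcard]; exact card_nsmul_eq_zero'
      exact_mod_cast this
    have hu : (l * Nat.gcdB k l : ℤ) • g ∈ T k := by
      rw [hT, ← natCast_zsmul, smul_smul,
        show (k : ℤ) * (l * Nat.gcdB k l) = Nat.gcdB k l * (k * l) by ring, mul_smul, hn,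
        smul_zero]
    have hv : (k * Nat.gcdA k l : ℤ) • g ∈ T l := by
      rw [hT, ← natCast_zsmul, smul_smul,
        show (l : ℤ) * (k * Nat.gcdA k l) = Nat.gcdA k l * (k * l) by ring, mul_smul, hn,
        smul_zero]
    have hs : g = (l * Nat.gcdB k l : ℤ) • g + (k * Nat.gcdA k l : ℤ) • g := by
      rw [← add_smul, add_comm, ← hb, one_smul]
    refine ⟨_, hu, _, hv, ?_, hs⟩
    conv_lhs => rw [hs]
    rw [hadd, (htriv _ hu _ hv).1]
  refine ⟨T k, T l, ⟨?_⟩, fun g => hT l g, ?_, ?_, ?_⟩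
  · intro n hn g
    obtain ⟨u, hu, v, hv, hg, -⟩ := hdec g
    rw [hg, show v * u * n * (v * u)⁻¹ = v * (u * n) * u⁻¹ * v⁻¹ by group, hcomm u hu n hn,
      show v * (n * u) * u⁻¹ * v⁻¹ = v * n * v⁻¹ by group]
    exact mul_mem (mul_mem hv hn) (inv_mem hv)
  · intro h hh s
    obtain ⟨u, hu, v, hv, hg, hg2⟩ := hdec s
    refine ⟨v⁻¹ * act h v, mul_mem (inv_mem hv) (hact l h v hv), ?_⟩
    have e : act h s = act h v * u := by
      conv_lhs => rw [hg2]
      rw [map_add, (htriv u hu h hh).2, hadd, (htriv u hu _ (hact l h v hv)).1]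
    rw [e, hg, ← hcomm u hu v hv, ← hcomm u hu _ (hact l h v hv)]
    group
  · have : Nat.card (T k) ∣ k * l := hcard ▸ Subgroup.card_subgroup_dvd_card _
    exact hcop2.dvd_of_dvd_mul_right this
  · intro g
    obtain ⟨u, hu, v, hv, hg, -⟩ := hdec g
    exact ⟨u, hu, v, hv, hg⟩

end Brace

namespace CycleSet

variable {X : Type*}

@[simp] theorem sigma_apply (C : CycleSet X) (x y : X) : C.sigma x y = C.mul x y := rfl

theorem sigma_mem (C : CycleSet X) (x : X) : C.sigma x ∈ C.G :=
  Subgroup.subset_closure ⟨x, rfl⟩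

/-- One step of the cocycle. -/
noncomputable def step (C : CycleSet X) (x : X) (g : Equiv.Perm X) : Equiv.Perm X :=
  C.sigma (g x) * g

instance (C : CycleSet X) : LeftCommutative C.step where
  left_comm := by
    intro x y g
    ext z
    simp only [step, Equiv.Perm.mul_apply, sigma_apply]
    exact C.cycloid _ _ _

/-- The cocycle from the free commutative monoid to the permutation group. -/
noncomputable def phi (C : CycleSet X) (s : Multiset X) : Equiv.Perm X :=
  Multiset.foldr C.step 1 s

theorem phi_zero (C : CycleSet X) : C.phi 0 = 1 := rfl

theorem phi_cons (C : CycleSet X) (x : X) (s : Multiset X) :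
    C.phi (x ::ₘ s) = C.sigma (C.phi s x) * C.phi s := by
  simp [phi, step]

theorem phi_add (C : CycleSet X) (a b : Multiset X) :
    C.phi (a + b) = C.phi (b.map (C.phi a)) * C.phi a := by
  induction b using Multiset.induction with
  | empty => simp [phi_zero]
  | cons x b ih =>
    rw [Multiset.add_cons, phi_cons, Multiset.map_cons, phi_cons, ih]
    simp [mul_assoc]

theorem phi_mem (C : CycleSet X) (a : Multiset X) : C.phi a ∈ C.G := by
  induction a using Multiset.induction with
  | empty => exact one_mem _
  | cons x b ih => rw [phi_cons]; exact mul_mem (C.sigma_mem _) ih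

theorem phi_mul (C : CycleSet X) (a c : Multiset X) :
    C.phi c * C.phi a = C.phi (a + c.map ((C.phi a)⁻¹ : Equiv.Perm X)) := by
  rw [phi_add, Multiset.map_map]
  congr 2
  simp

theorem phi_surj [Finite X] (C : CycleSet X) (g : Equiv.Perm X) (hg : g ∈ C.G) :
    ∃ a, C.phi a = g := by
  have hpow : ∀ a : Multiset X, ∀ n : ℕ, ∃ b, C.phi b = C.phi a ^ n := by
    intro a n
    induction n with
    | zero => exact ⟨0, by simp [phi_zero]⟩
    | succ n ih =>
      obtain ⟨b, hb⟩ := ih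
      exact ⟨_, by rw [pow_succ, ← hb, phi_mul]⟩
  induction hg using Subgroup.closure_induction with
  | mem x hx =>
    obtain ⟨x, rfl⟩ := hx
    exact ⟨{x}, by rw [← Multiset.cons_zero, phi_cons, phi_zero]; simp⟩
  | one => exact ⟨0, rfl⟩
  | mul x y _ _ hx hy =>
    obtain ⟨a, rfl⟩ := hx
    obtain ⟨b, rfl⟩ := hy
    exact ⟨_, (phi_mul C b a).symm⟩
  | inv x _ hx =>
    obtain ⟨a, rfl⟩ := hx
    obtain ⟨b, hb⟩ := hpow a (orderOf (C.phi a) - 1)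
    refine ⟨b, ?_⟩
    rw [hb, eq_comm, inv_eq_iff_mul_eq_one, ← pow_succ',
      Nat.sub_add_cancel (orderOf_pos _), pow_orderOf_eq_one]

theorem phi_map [Finite X] (C : CycleSet X) (g : Equiv.Perm X) (hg : g ∈ C.G)
    (a a' : Multiset X) (h : C.phi a = C.phi a') : C.phi (a.map g) = C.phi (a'.map g) := by
  obtain ⟨b, rfl⟩ := C.phi_surj g hg
  have h2 : C.phi (b + a) = C.phi (b + a') := by
    rw [add_comm b a, add_comm b a', phi_add, phi_add, h]
  rw [phi_add, phi_add] at h2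
  exact mul_right_cancel h2

/-- The brace structure on the permutation group. -/
theorem exists_brace [Finite X] (C : CycleSet X) :
    ∃ (_ : AddCommGroup C.G) (act : C.G → C.G →+ C.G),
      (∀ g h, g + h = act g h * g) ∧ (∀ g, act 1 g = g) ∧
      (∀ g h x, act (g * h) x = act g (act h x)) ∧
      (∀ (g : C.G) (x : X), (act g ⟨C.sigma x, C.sigma_mem x⟩ : Equiv.Perm X) =
        C.sigma ((g : Equiv.Perm X) x)) := by
  let ψ : Multiset X → C.G := fun a => ⟨C.phi a, C.phi_mem a⟩
  have hψ : ∀ a, ((ψ a : C.G) : Equiv.Perm X) = C.phi a := fun _ => rfl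
  have hs : Function.Surjective ψ := fun g => by
    obtain ⟨a, ha⟩ := C.phi_surj g g.2
    exact ⟨a, Subtype.ext ha⟩
  choose s hsec using hs
  let act : C.G → C.G → C.G := fun g h => ψ ((s h).map (g : Equiv.Perm X))
  have hact : ∀ (g : C.G) a, act g (ψ a) = ψ (a.map (g : Equiv.Perm X)) := by
    intro g a
    apply Subtype.ext
    exact C.phi_map g g.2 _ _ (congrArg Subtype.val (hsec (ψ a)))
  let add : C.G → C.G → C.G := fun g h => act g h * g
  have hadd : ∀ a b, add (ψ a) (ψ b) = ψ (a + b) := by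
    intro a b
    apply Subtype.ext
    simp only [add, hact, Subgroup.coe_mul, hψ, phi_add]
  have hz : ψ 0 = 1 := rfl
  have act1 : ∀ g, act 1 g = g := by
    intro g
    obtain ⟨a, rfl⟩ : ∃ a, ψ a = g := ⟨_, hsec g⟩
    rw [hact]; simp
  have actm : ∀ g h x, act (g * h) x = act g (act h x) := by
    intro g h x
    obtain ⟨a, rfl⟩ : ∃ a, ψ a = x := ⟨_, hsec x⟩
    rw [hact (g * h), hact h, hact g, Multiset.map_map]; rfl
  have acta : ∀ g x y, act g (add x y) = add (act g x) (act g y) := by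
    intro g x y
    obtain ⟨a, rfl⟩ : ∃ a, ψ a = x := ⟨_, hsec x⟩
    obtain ⟨b, rfl⟩ : ∃ a, ψ a = y := ⟨_, hsec y⟩
    rw [hadd, hact, hact, hact, hadd, Multiset.map_add]
  have act0 : ∀ g, act g 1 = 1 := by
    intro g
    rw [← hz, hact, Multiset.map_zero]
  have hcomm : ∀ x y, add x y = add y x := by
    intro x y
    obtain ⟨a, rfl⟩ : ∃ a, ψ a = x := ⟨_, hsec x⟩
    obtain ⟨b, rfl⟩ : ∃ a, ψ a = y := ⟨_, hsec y⟩
    rw [hadd, hadd, add_comm]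
  have hassoc : ∀ x y z, add (add x y) z = add x (add y z) := by
    intro x y z
    obtain ⟨a, rfl⟩ : ∃ a, ψ a = x := ⟨_, hsec x⟩
    obtain ⟨b, rfl⟩ : ∃ a, ψ a = y := ⟨_, hsec y⟩
    obtain ⟨c, rfl⟩ : ∃ a, ψ a = z := ⟨_, hsec z⟩
    rw [hadd, hadd, hadd, hadd, add_assoc]
  have hadd0 : ∀ x, add x 1 = x := by
    intro x
    simp only [add, act0, one_mul]
  have hneg : ∀ x, add x (act x⁻¹ x⁻¹) = 1 := by
    intro x
    simp only [add]
    rw [← actm, mul_inv_cancel, act1, inv_mul_cancel]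
  let I : AddCommGroup C.G :=
    { add := add
      zero := (1 : C.G)
      neg := fun x => act x⁻¹ x⁻¹
      add_assoc := hassoc
      zero_add := fun x => (hcomm _ _).trans (hadd0 x)
      add_zero := hadd0
      add_comm := hcomm
      neg_add_cancel := fun x => (hcomm _ _).trans (hneg x)
      nsmul := @nsmulRec _ ⟨(1 : C.G)⟩ ⟨add⟩
      zsmul := @zsmulRec _ ⟨(1 : C.G)⟩ ⟨add⟩ ⟨fun x => act x⁻¹ x⁻¹⟩
        (@nsmulRec _ ⟨(1 : C.G)⟩ ⟨add⟩) }
  refine ⟨I, fun g => { toFun := act g, map_zero' := act0 g, map_add' := acta g },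
    fun g h => rfl, act1, actm, ?_⟩
  intro g x
  have e : ∀ x, ψ {x} = ⟨C.sigma x, C.sigma_mem x⟩ := by
    intro x
    apply Subtype.ext
    rw [hψ, ← Multiset.cons_zero, phi_cons, phi_zero]; simp
  change ((act g _ : C.G) : Equiv.Perm X) = _
  rw [← e, hact, Multiset.map_singleton, e]

/-- Quotient of a cycle set by the orbits of a suitable normal subgroup. -/
theorem exists_quot {X : Type} [Finite X] (C : CycleSet X) (htr : C.Indecomposable)
    (N : Subgroup C.G) (hN : N.Normal)
    (hs : ∀ h ∈ N, ∀ x, ∃ t ∈ N, C.sigma ((h : Equiv.Perm X) x) =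
      C.sigma x * (t : Equiv.Perm X)) :
    ∃ (Y : Type) (D : CycleSet Y) (q : X → Y), Function.Surjective q ∧ D.Indecomposable ∧
      (∀ x y, q x = q y ↔ ∃ g ∈ N, (g : Equiv.Perm X) x = y) ∧
      ∀ x y, q (C.mul x y) = D.mul (q x) (q y) := by
  let S : Setoid X :=
    { r := fun x y => ∃ g ∈ N, (g : Equiv.Perm X) x = y
      iseqv :=
        { refl := fun x => ⟨1, one_mem _, rfl⟩
          symm := by
            rintro x y ⟨g, hg, rfl⟩
            exact ⟨g⁻¹, inv_mem hg, by simp⟩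
          trans := by
            rintro x y z ⟨g, hg, rfl⟩ ⟨h, hh, rfl⟩
            exact ⟨h * g, mul_mem hh hg, rfl⟩ } }
  have hq : ∀ x y, (Quotient.mk S x = Quotient.mk S y) ↔
      ∃ g ∈ N, (g : Equiv.Perm X) x = y := fun x y => Quotient.eq
  have hmove : ∀ (g : C.G) (h : C.G), h ∈ N → ∀ x : X,
      Quotient.mk S ((g : Equiv.Perm X) x) =
        Quotient.mk S ((g : Equiv.Perm X) ((h : Equiv.Perm X) x)) := by
    intro g h hh x
    rw [hq]
    exact ⟨g * h * g⁻¹, hN.conj_mem h hh g, by simp⟩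
  let mul : Quotient S → Quotient S → Quotient S :=
    Quotient.map₂ C.mul (by
      rintro a _ ⟨h, hh, rfl⟩ b _ ⟨k, hk, rfl⟩
      apply Quotient.exact
      obtain ⟨t, ht, e⟩ := hs h hh a
      have e2 : C.mul ((h : Equiv.Perm X) a) ((k : Equiv.Perm X) b) =
          C.sigma a (((t * k : C.G) : Equiv.Perm X) b) := by
        rw [← sigma_apply, e]; rfl
      rw [e2]
      exact hmove ⟨C.sigma a, C.sigma_mem a⟩ (t * k) (mul_mem ht hk) b)
  have hmul : ∀ a b, mul (Quotient.mk S a) (Quotient.mk S b) = Quotient.mk S (C.mul a b) :=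
    fun a b => rfl
  let D : CycleSet (Quotient S) :=
    { mul := mul
      mul_bijective := by
        intro x
        apply Function.Surjective.bijective_of_finite
        intro y
        induction x using Quotient.inductionOn with | _ x => ?_
        induction y using Quotient.inductionOn with | _ y => ?_
        obtain ⟨z, rfl⟩ := (C.mul_bijective x).2 y
        exact ⟨Quotient.mk S z, rfl⟩
      cycloid := by
        intro x y z
        induction x using Quotient.inductionOn with | _ x => ?_
        induction y using Quotient.inductionOn with | _ y => ?_
        induction z using Quotient.inductionOn with | _ z => ?_
        simp only [hmul, C.cycloid x y z]
      nondeg := by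
        apply Function.Surjective.bijective_of_finite
        intro y
        induction y using Quotient.inductionOn with | _ y => ?_
        obtain ⟨z, rfl⟩ := C.nondeg.2 y
        exact ⟨Quotient.mk S z, rfl⟩ }
  refine ⟨Quotient S, D, Quotient.mk S, Quotient.mk_surjective, ?_, hq, fun _ _ => rfl⟩
  have key : ∀ g ∈ C.G, ∃ g' ∈ D.G, ∀ x, g' (Quotient.mk S x) = Quotient.mk S (g x) := by
    intro g hg
    induction hg using Subgroup.closure_induction with
    | mem x hx =>
      obtain ⟨x, rfl⟩ := hx
      exact ⟨D.sigma (Quotient.mk S x), D.sigma_mem _, fun _ => rfl⟩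
    | one => exact ⟨1, one_mem _, fun _ => rfl⟩
    | mul x y _ _ hx hy =>
      obtain ⟨a, ha, ha'⟩ := hx
      obtain ⟨b, hb, hb'⟩ := hy
      exact ⟨a * b, mul_mem ha hb, fun z => by simp [ha', hb']⟩
    | inv x _ hx =>
      obtain ⟨a, ha, ha'⟩ := hx
      refine ⟨a⁻¹, inv_mem ha, fun z => ?_⟩
      rw [Equiv.Perm.inv_eq_iff_eq, ha']
      simp
  intro x y
  induction x using Quotient.inductionOn with | _ x => ?_
  induction y using Quotient.inductionOn with | _ y => ?_
  obtain ⟨g, hg, rfl⟩ := htr x y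
  obtain ⟨g', hg', e⟩ := key g hg
  exact ⟨g', hg', e x⟩

end CycleSet

/-- A uniconnected cycle set of cardinality `p₁^{n₁} ⋯ p_m^{n_m}` with
nilpotent permutation group is isomorphic to a direct product of `m` indecomposable
cycle sets of cardinalities `p_i^{n_i}`. -/
theorem stmt0 {X : Type} [Finite X] (C : CycleSet X) (m : ℕ) (p n : Fin m → ℕ)
    (hp : ∀ i, (p i).Prime) (hdist : Function.Injective p)
    (hcard : Nat.card X = ∏ i, p i ^ n i)
    (huni : C.Uniconnected) (hnil : Group.IsNilpotent C.G) :
    ∃ (Y : Fin m → Type) (D : ∀ i, CycleSet (Y i)),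
      (∀ i, Nat.card (Y i) = p i ^ n i) ∧
      (∀ i, (D i).Indecomposable) ∧
      ∃ (P : CycleSet (∀ i, Y i)) (f : X ≃ ∀ i, Y i),
        (∀ a b i, P.mul a b i = (D i).mul (a i) (b i)) ∧
        ∀ a b, f (C.mul a b) = P.mul (f a) (f b) := by
  have hcardpos : 0 < Nat.card X := by
    rw [hcard]; exact Finset.prod_pos fun i _ => pow_pos (hp i).pos _
  have : Nonempty X := (Nat.card_pos_iff.mp hcardpos).1
  obtain ⟨x0⟩ := this
  have htr : C.Indecomposable := fun x y => (huni x y).exists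
  have hG : Nat.card C.G = Nat.card X := by
    apply Nat.card_congr
    refine Equiv.ofBijective (fun g : C.G => (g : Equiv.Perm X) x0) ⟨?_, ?_⟩
    · intro g h e
      exact Subtype.ext ((huni x0 ((h : Equiv.Perm X) x0)).unique ⟨g.2, e⟩ ⟨h.2, rfl⟩)
    · intro y
      obtain ⟨g, hg, e⟩ := htr x0 y
      exact ⟨⟨g, hg⟩, e⟩
  obtain ⟨I, act, hadd, h1, hmul, hsig⟩ := C.exists_brace
  let r : Fin m → ℕ := fun i => ∏ j ∈ Finset.univ.erase i, p j ^ n j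
  have hr : ∀ i, p i ^ n i * r i = Nat.card X := fun i => by
    rw [hcard]; exact Finset.mul_prod_erase _ (fun j => p j ^ n j) (Finset.mem_univ i)
  have hcop : ∀ i, (p i ^ n i).Coprime (r i) := fun i => by
    apply Nat.Coprime.prod_right
    intro j hj
    apply Nat.Coprime.pow
    rw [Nat.coprime_primes (hp i) (hp j)]
    intro e
    exact (Finset.ne_of_mem_erase hj) (hdist e).symm
  have main : ∀ i, ∃ (Y : Type) (D : CycleSet Y) (q : X → Y), Function.Surjective q ∧
      D.Indecomposable ∧ (∀ x y, q x = q y ↔ ∃ g : C.G, r i • g = 0 ∧ (g : Equiv.Perm X) x = y) ∧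
      (∀ x y, q (C.mul x y) = D.mul (q x) (q y)) ∧ Nat.card Y ≤ p i ^ n i := by
    intro i
    obtain ⟨H, N, hN, hNm, hNs, hH, hdec⟩ :=
      brace_pair hnil act hadd h1 hmul _ _ (hcop i) (hG.trans (hr i).symm)
    obtain ⟨Y, D, q, hq, hD, hqe, hqm⟩ := C.exists_quot htr N hN (by
      intro h hh x
      obtain ⟨t, ht, e⟩ := hNs h hh ⟨C.sigma x, C.sigma_mem x⟩
      refine ⟨t, ht, ?_⟩
      rw [← hsig, e]; rfl)
    refine ⟨Y, D, q, hq, hD, ?_, hqm, ?_⟩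
    · intro x y
      rw [hqe]
      simp only [hNm]
    · refine le_trans ?_ (Nat.le_of_dvd (pow_pos (hp i).pos _) hH)
      apply Nat.card_le_card_of_surjective
        (fun u : H => q (((u : C.G) : Equiv.Perm X) x0))
      intro y
      obtain ⟨x, rfl⟩ := hq y
      obtain ⟨g, hg, rfl⟩ := htr x0 x
      obtain ⟨u, hu, v, hv, e⟩ := hdec ⟨g, hg⟩
      refine ⟨⟨u, hu⟩, ?_⟩
      rw [hqe]
      refine ⟨v, hv, ?_⟩
      have := congrArg Subtype.val e
      simp only at this
      rw [this]; rfl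
  choose Y D q hq hD hqe hqm hY using main
  have hfin : ∀ i, Finite (Y i) := fun i => Finite.of_surjective _ (hq i)
  let f : X → ∀ i, Y i := fun x i => q i x
  have h01 : (0 : C.G) = 1 := by
    have := hadd 1 0
    rwa [h1, mul_one, add_zero, eq_comm] at this
  have hf : Function.Injective f := by
    intro x y hxy
    obtain ⟨g, hg, rfl⟩ := htr x y
    have hk : ∀ i, addOrderOf (⟨g, hg⟩ : C.G) ∣ r i := by
      intro i
      obtain ⟨h, h0, e⟩ := (hqe i _ _).mp (congrFun hxy i)
      have : h = ⟨g, hg⟩ := Subtype.ext ((huni x (g x)).unique ⟨h.2, e⟩ ⟨hg, rfl⟩)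
      rw [← this]
      exact addOrderOf_dvd_of_nsmul_eq_zero h0
    have hone : addOrderOf (⟨g, hg⟩ : C.G) = 1 := by
      by_contra hne
      obtain ⟨l, hl, hld⟩ := Nat.exists_prime_and_dvd hne
      have h2 : l ∣ ∏ i, p i ^ n i := by
        rw [← hcard, ← hG]; exact hld.trans (addOrderOf_dvd_natCard _)
      obtain ⟨i, -, hi⟩ := (hl.prime.dvd_finsetProd_iff _).mp h2
      exact Nat.not_coprime_of_dvd_of_dvd hl.one_lt hi (hld.trans (hk i)) (hcop i)
    rw [AddMonoid.addOrderOf_eq_one_iff, h01] at hone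
    have := congrArg Subtype.val hone
    simp only [Subgroup.coe_one] at this
    rw [this]; rfl
  have hle : Nat.card X ≤ ∏ i, Nat.card (Y i) := by
    rw [← Nat.card_pi]; exact Nat.card_le_card_of_injective f hf
  have hYc : ∀ i, Nat.card (Y i) = p i ^ n i := by
    intro i
    by_contra hne
    have hlt : Nat.card (Y i) < p i ^ n i := lt_of_le_of_ne (hY i) hne
    have hYpos : ∀ j, 0 < Nat.card (Y j) := fun j =>
      Nat.card_pos_iff.mpr ⟨⟨q j x0⟩, hfin j⟩
    have := Finset.prod_lt_prod (s := Finset.univ) (fun j _ => hYpos j) (fun j _ => hY j)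
      ⟨i, Finset.mem_univ i, hlt⟩
    rw [hcard] at hle
    omega
  have hbij : Function.Bijective f := by
    rw [Nat.bijective_iff_injective_and_card]
    refine ⟨hf, ?_⟩
    rw [Nat.card_pi, hcard]
    exact Finset.prod_congr rfl fun i _ => (hYc i).symm
  let P : CycleSet (∀ i, Y i) :=
    { mul := fun a b i => (D i).mul (a i) (b i)
      mul_bijective := fun a => Function.Bijective.piMap fun i => (D i).mul_bijective (a i)
      cycloid := fun x y z => funext fun i => (D i).cycloid _ _ _
      nondeg := Function.Bijective.piMap fun i => (D i).nondeg }
  refine ⟨Y, D, hYc, hD, P, Equiv.ofBijective f hbij, fun _ _ _ => rfl, ?_⟩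
  intro a b
  funext i
  exact hqm i a b
end

section
/- Let (X,·) be an infinite indecomposable cycle set such that 𝒢(X) is isomorphic to the infinite cyclic group (ℤ,+). Then (X,·) is isomorphic, as a cycle set, to the cycle set on ℤ defined by a·b := b + 1 for all a, b ∈ ℤ. -/
theorem ringLemma {E : Type*} [Ring E] (T B : ℤ → E) (hT0 : T 0 = 1)
    (hT : ∀ m n, T (m + n) = T m * T n) (hBinj : Function.Injective B) (hB0 : B 0 = 0)
    (hB : ∀ n, B (n + 1) = B n + T n) (hBc : ∀ n m, Commute (B n) (T m))
    (hs : ∀ r, (∀ m, Commute r (T m)) → ∃ n, r = B n) : T 1 = 1 := by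
  have hTc : ∀ m n, Commute (T m) (T n) := by
    intro m n
    rw [commute_iff_eq, ← hT, ← hT, add_comm]
  have hB' : ∀ n, B (n - 1) = B n - T (n - 1) := by
    intro n
    have := hB (n - 1)
    rw [sub_add_cancel] at this
    rw [this, add_sub_cancel_right]
  have key : ∀ n, (T 1 - 1) * B n = T n - 1 := by
    intro n
    induction n using Int.induction_on with
    | zero => rw [hB0, hT0, mul_zero, sub_self]
    | succ i ih =>
      rw [hB, mul_add, ih, add_comm (i : ℤ) 1, hT]
      noncomm_ring
    | pred i ih =>
      rw [hB', mul_sub, ih]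
      have : T (-(i : ℤ)) = T 1 * T (-(i : ℤ) - 1) := by
        rw [← hT]; congr 1; ring
      rw [this]
      noncomm_ring
  have key2 : ∀ r, (∀ m, Commute r (T m)) → ∃ n, 1 + (T 1 - 1) * r = T n := by
    intro r hr
    obtain ⟨n, rfl⟩ := hs r hr
    exact ⟨n, by rw [key]; abel⟩
  have key3 : ∀ n : ℤ, ∃ x, (∀ m, Commute x (T m)) ∧ B n = (n : E) + (T 1 - 1) * x := by
    intro n
    induction n using Int.induction_on with
    | zero => exact ⟨0, fun m => Commute.zero_left _, by simp [hB0]⟩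
    | succ i ih =>
      obtain ⟨x, hx, h⟩ := ih
      refine ⟨x + B i, fun m => (hx m).add_left (hBc _ _), ?_⟩
      rw [hB, mul_add, key, h]
      push_cast
      abel
    | pred i ih =>
      obtain ⟨x, hx, h⟩ := ih
      refine ⟨x - B (-(i : ℤ) - 1), fun m => (hx m).sub_left (hBc _ _), ?_⟩
      rw [mul_sub, key, hB', h]
      push_cast
      abel
  by_contra hne
  obtain ⟨k, hk⟩ := hs (T 1 - 1) (fun m => (hTc 1 m).sub_left (Commute.one_left _))
  have hk0 : k ≠ 0 := by
    rintro rfl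
    rw [hB0] at hk
    exact hne (sub_eq_zero.1 hk)
  obtain ⟨K, hKpos, x, hx, hK⟩ : ∃ K : ℕ, 0 < K ∧ ∃ x, (∀ m, Commute x (T m)) ∧
      (K : E) = (T 1 - 1) * x := by
    obtain ⟨x, hx, h⟩ := key3 k
    have h1 : (k : E) = (T 1 - 1) * (1 - x) := by
      rw [mul_sub, mul_one, eq_sub_iff_add_eq, ← h, hk]
    refine ⟨k.natAbs, Int.natAbs_pos.2 hk0, ?_⟩
    rcases Int.natAbs_eq k with h2 | h2
    · refine ⟨1 - x, fun m => (Commute.one_left _).sub_left (hx m), ?_⟩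
      rw [← h1, h2]; simp
    · refine ⟨-(1 - x), fun m => ((Commute.one_left _).sub_left (hx m)).neg_left, ?_⟩
      rw [mul_neg, ← h1, h2]; simp
  by_cases htor : ∃ m : ℕ, 0 < m ∧ (m : E) = 0
  · obtain ⟨m, hm, hm0⟩ := htor
    have hint : IsIntegral ℤ (T 1) := by
      obtain ⟨j, hj⟩ := key2 (T 1) (hTc 1)
      have hj' : T 1 ^ 2 - T 1 + 1 = T j := by
        rw [← hj]; noncomm_ring
      have hp : ∀ n : ℕ, T n = T 1 ^ n := by
        intro n
        induction n with
        | zero => simpa using hT0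
        | succ n ih => push_cast; rw [hT, ih, pow_succ]
      have hcase : j < 0 ∨ j = 0 ∨ j = 1 ∨ j = 2 ∨ 3 ≤ j := by omega
      rcases hcase with h | rfl | rfl | rfl | h
      · obtain ⟨n, rfl⟩ : ∃ n : ℕ, j = -(n : ℤ) := ⟨j.natAbs, by omega⟩
        have h2 : (T 1 ^ 2 - T 1 + 1) * T 1 ^ n = 1 := by
          rw [hj', ← hp, ← hT, neg_add_cancel, hT0]
        refine ⟨(Polynomial.X ^ 2 - Polynomial.X + 1) * Polynomial.X ^ n - 1, ?_, ?_⟩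
        · have : 0 < n := by omega
          have h3 : (Polynomial.X ^ 2 - Polynomial.X + 1 : Polynomial ℤ).Monic := by monicity!
          refine (h3.mul (Polynomial.monic_X_pow n)).sub_of_left ?_
          rw [Polynomial.degree_mul, Polynomial.degree_X_pow, Polynomial.degree_one]
          have : (Polynomial.X ^ 2 - Polynomial.X + 1 : Polynomial ℤ).degree = 2 := by
            compute_degree!
          rw [this]
          norm_cast
          omega
        · rw [← Polynomial.aeval_def]
          simp [h2]
      · exfalso
        rw [hT0] at hj'
        apply hne
        have h1 : T 1 * (T 1 - 1) = 0 := by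
          have : T 1 * (T 1 - 1) = (T 1 ^ 2 - T 1 + 1) - 1 := by noncomm_ring
          rw [this, hj', sub_self]
        have h2 : T (-1) * T 1 = 1 := by rw [← hT]; simpa using hT0
        have := congrArg (T (-1) * ·) h1
        simp only [← mul_assoc, h2, one_mul, mul_zero] at this
        exact sub_eq_zero.1 this
      · refine ⟨Polynomial.X ^ 2 - Polynomial.X + 1 - Polynomial.X, by monicity!, ?_⟩
        rw [← Polynomial.aeval_def]
        simp [hj']
      · exfalso
        apply hne
        have := hp 2
        push_cast at this
        rw [this] at hj'
        have h3 : T 1 ^ 2 - T 1 + 1 - T 1 ^ 2 = 0 := by rw [hj', sub_self]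
        have h4 : 1 - T 1 = 0 := by rw [← h3]; abel
        exact (sub_eq_zero.1 h4).symm
      · obtain ⟨n, rfl⟩ : ∃ n : ℕ, j = (n : ℤ) := ⟨j.natAbs, by omega⟩
        rw [hp] at hj'
        refine ⟨Polynomial.X ^ n - (Polynomial.X ^ 2 - Polynomial.X + 1), ?_, ?_⟩
        · refine (Polynomial.monic_X_pow n).sub_of_left ?_
          rw [Polynomial.degree_X_pow]
          have : (Polynomial.X ^ 2 - Polynomial.X + 1 : Polynomial ℤ).degree = 2 := by
            compute_degree!
          rw [this]
          norm_cast at h ⊢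
        · rw [← Polynomial.aeval_def]
          simp [hj']
    have hfg := hint.fg_adjoin_singleton
    set A := Algebra.adjoin ℤ {T 1} with hA
    have : Module.Finite ℤ A := Module.Finite.iff_fg.2 hfg
    have hfin : Finite A := by
      apply Module.finite_of_fg_torsion
      intro y
      refine ⟨⟨(m : ℤ), ?_⟩, ?_⟩
      · exact mem_nonZeroDivisors_of_ne_zero (by exact_mod_cast hm.ne')
      · apply Subtype.ext
        change (m : ℤ) • (y : E) = 0
        rw [zsmul_eq_mul]
        simp [hm0]
    have hTA : ∀ n : ℕ, T n ∈ A := by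
      intro n
      induction n with
      | zero => simpa [hT0] using A.one_mem
      | succ n ih =>
        push_cast
        rw [hT]
        exact A.mul_mem ih (Algebra.subset_adjoin rfl)
    have hBA : ∀ n : ℕ, B n ∈ A := by
      intro n
      induction n with
      | zero => simpa [hB0] using A.zero_mem
      | succ n ih =>
        push_cast
        rw [hB]
        exact A.add_mem ih (hTA n)
    refine not_injective_infinite_finite (fun n : ℕ => (⟨B n, hBA n⟩ : A)) ?_
    intro i j hij
    have := hBinj (congrArg Subtype.val hij)
    exact_mod_cast this
  · have hinj : ∀ i j : ℕ, (i : E) = j → i = j := by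
      have aux : ∀ i j : ℕ, i ≤ j → (i : E) = j → i = j := by
        intro i j hij h
        by_contra hn
        refine htor ⟨j - i, by omega, ?_⟩
        rw [Nat.cast_sub hij, h, sub_self]
      intro i j h
      rcases le_total i j with h1 | h1
      · exact aux i j h1 h
      · exact (aux j i h1 h.symm).symm
    obtain ⟨a, ha⟩ := key2 x hx
    obtain ⟨b, hb⟩ := key2 (x + x) (fun m => (hx m).add_left (hx m))
    rw [mul_add, ← hK] at hb
    rw [← hK] at ha
    have hu : ((1 + K : ℕ) : E) = T a := by rw [← ha]; push_cast; rfl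
    have hv : ((1 + 2 * K : ℕ) : E) = T b := by rw [← hb]; push_cast; rw [two_mul]
    have hpow : ∀ (c : ℤ) (n : ℕ), T c ^ n = T (c * n) := by
      intro c n
      induction n with
      | zero => simp [hT0]
      | succ n ih => rw [pow_succ, ih, ← hT]; congr 1; push_cast; ring
    have ha0 : a ≠ 0 := by
      rintro rfl
      rw [hT0] at hu
      have := hinj (1 + K) 1 (by rw [hu, Nat.cast_one])
      omega
    have hb0 : b ≠ 0 := by
      rintro rfl
      rw [hT0] at hv
      have := hinj (1 + 2 * K) 1 (by rw [hv, Nat.cast_one])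
      omega
    have hb1 : b.natAbs ≠ 0 := by omega
    have hcop : Nat.Coprime (1 + K) (1 + 2 * K) := by
      have : 1 + 2 * K = K + (1 + K) := by ring
      rw [this]
      simp
    have e1 : (((1 + K) ^ b.natAbs : ℕ) : E) = T (a * b.natAbs) := by
      rw [Nat.cast_pow, hu, hpow]
    have e2 : (((1 + 2 * K) ^ a.natAbs : ℕ) : E) = T (b * a.natAbs) := by
      rw [Nat.cast_pow, hv, hpow]
    have hsgn : a * b.natAbs = b * a.natAbs ∨ a * b.natAbs + b * a.natAbs = 0 := by
      rcases Int.natAbs_eq a with h | h <;> rcases Int.natAbs_eq b with h' | h' <;>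
        generalize a.natAbs = p at * <;> generalize b.natAbs = q at * <;> subst h <;> subst h'
      · left; ring
      · right; ring
      · right; ring
      · left; ring
    have hone : (1 + K) ^ b.natAbs = 1 := by
      rcases hsgn with h | h
      · have h1 : (1 + K) ^ b.natAbs = (1 + 2 * K) ^ a.natAbs := hinj _ _ (by rw [e1, e2, h])
        have h2 : Nat.Coprime ((1 + K) ^ b.natAbs) ((1 + 2 * K) ^ a.natAbs) :=
          Nat.Coprime.pow _ _ hcop
        rw [← h1] at h2
        simpa using h2
      · have h1 : (1 + K) ^ b.natAbs * (1 + 2 * K) ^ a.natAbs = 1 :=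
          hinj _ _ (by rw [Nat.cast_mul, e1, e2, ← hT, h, hT0, Nat.cast_one])
        exact Nat.eq_one_of_mul_eq_one_right h1
    rw [Nat.pow_eq_one] at hone
    omega

theorem moduleLemma {M : Type*} [AddCommGroup M] (T : ℤ → AddMonoid.End M) (hT0 : T 0 = 1)
    (hT : ∀ m n, T (m + n) = T m * T n) (ψ : ℤ → M) (hψ : Function.Bijective ψ)
    (hadd : ∀ m n, ψ (m + n) = ψ m + T m (ψ n)) : T 1 = 1 := by
  have h0 : ψ 0 = 0 := by
    have := hadd 0 0
    rw [hT0] at this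
    simpa using this
  have hTc : ∀ m n, Commute (T m) (T n) := by
    intro m n
    rw [commute_iff_eq, ← hT, ← hT, add_comm]
  have hex : ∀ n : ℤ, ∃ r : AddMonoid.End M, r (ψ 1) = ψ n ∧
      ∀ z : AddMonoid.End M, (∀ m, Commute z (T m)) → Commute z r := by
    intro n
    induction n using Int.induction_on with
    | zero => exact ⟨0, by simp [h0], fun z _ => Commute.zero_right _⟩
    | succ i ih =>
      obtain ⟨r, h1, h2⟩ := ih
      exact ⟨r + T i, by rw [hadd, ← h1]; rfl,
        fun z hz => (h2 z hz).add_right (hz _)⟩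
    | pred i ih =>
      obtain ⟨r, h1, h2⟩ := ih
      refine ⟨r - T (-(i : ℤ) - 1), ?_, fun z hz => (h2 z hz).sub_right (hz _)⟩
      have := hadd (-(i : ℤ) - 1) 1
      rw [sub_add_cancel] at this
      change r (ψ 1) - T (-(i : ℤ) - 1) (ψ 1) = _
      rw [h1, this, add_sub_cancel_right]
  choose B hBe hBz using hex
  have hBc : ∀ n m, Commute (B n) (T m) := fun n m => (hBz n (T m) (hTc m)).symm
  have hext : ∀ r r' : AddMonoid.End M, (∀ m, Commute r (T m)) → (∀ m, Commute r' (T m)) →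
      r (ψ 1) = r' (ψ 1) → r = r' := by
    intro r r' hr hr' h
    ext y
    obtain ⟨n, rfl⟩ := hψ.2 y
    rw [← hBe n]
    change (r * B n) (ψ 1) = (r' * B n) (ψ 1)
    rw [(hBz n r hr).eq, (hBz n r' hr').eq]
    exact congrArg (B n) h
  refine ringLemma T B hT0 hT ?_ ?_ ?_ hBc ?_
  · intro i j h
    apply hψ.1
    rw [← hBe i, ← hBe j, h]
  · refine hext _ _ (hBc 0) (fun m => Commute.zero_left _) ?_
    rw [hBe, h0]; rfl
  · intro n
    refine hext _ _ (hBc _) (fun m => (hBc _ m).add_left (hTc _ _)) ?_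
    rw [hBe, hadd, ← hBe n]; rfl
  · intro r hr
    obtain ⟨n, hn⟩ := hψ.2 (r (ψ 1))
    exact ⟨n, hext _ _ hr (hBc n) (by rw [hBe, hn])⟩

theorem coreLemma (f : ℤ → ℤ) (hf : ∀ x y, f x + f (y + f x) = f y + f (x + f y))
    (hbij : Function.Bijective (fun x => x + f x))
    (hgen : AddSubgroup.closure (Set.range f) = ⊤) : ∀ x, f (x + 1) = f x := by
  have hpb : ∀ x, Function.Bijective (fun n => n + f (x + n)) := by
    intro x
    have : (fun n => n + f (x + n)) =
        (Equiv.addLeft (-x)) ∘ (fun x => x + f x) ∘ (Equiv.addLeft x) := by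
      funext n
      simp
      ring
    rw [this]
    exact (Equiv.bijective _).comp (hbij.comp (Equiv.bijective _))
  let π : ℤ → Equiv.Perm ℤ := fun x => Equiv.ofBijective _ (hpb x)
  have hπ : ∀ x n, π x n = n + f (x + n) := fun x n => rfl
  have hcomm : ∀ p ∈ Set.range π, ∀ q ∈ Set.range π, p * q = q * p := by
    rintro _ ⟨x, rfl⟩ _ ⟨y, rfl⟩
    ext n
    simp only [Equiv.Perm.mul_apply, hπ]
    have := hf (y + n) (x + n)
    rw [← add_assoc x, ← add_assoc y]
    linarith
  let P := Subgroup.closure (Set.range π)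
  letI : CommGroup P := Subgroup.closureCommGroupOfComm hcomm
  have hSP : ∀ (m : ℤ), ∀ p ∈ P, Equiv.addLeft m * p * (Equiv.addLeft m)⁻¹ ∈ P := by
    intro m p hp
    have hle : P ≤ P.comap (MulAut.conj (Equiv.addLeft m : Equiv.Perm ℤ)).toMonoidHom := by
      refine (Subgroup.closure_le _).2 ?_
      rintro _ ⟨x, rfl⟩
      refine Subgroup.subset_closure ⟨x - m, ?_⟩
      ext n
      change π (x - m) n = m + π x (-m + n)
      rw [hπ, hπ]
      have : x - m + n = x + (-m + n) := by ring
      rw [this]; ring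
    exact hle hp
  let T : ℤ → AddMonoid.End (Additive P) := fun m =>
    { toFun := fun p => Additive.ofMul ⟨_, hSP m p.toMul.1 p.toMul.2⟩
      map_zero' := by
        apply Additive.toMul.injective
        apply Subtype.ext
        change Equiv.addLeft m * (1 : Equiv.Perm ℤ) * (Equiv.addLeft m)⁻¹ = 1
        group
      map_add' := by
        intro p q
        apply Additive.toMul.injective
        apply Subtype.ext
        change Equiv.addLeft m * (p.toMul.1 * q.toMul.1) * (Equiv.addLeft m)⁻¹ =
          (Equiv.addLeft m * p.toMul.1 * (Equiv.addLeft m)⁻¹) *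
          (Equiv.addLeft m * q.toMul.1 * (Equiv.addLeft m)⁻¹)
        group }
  have hTa : ∀ m (p : Additive P) (n : ℤ), (T m p).toMul.1 n = m + p.toMul.1 (-m + n) :=
    fun m p n => rfl
  have hextP : ∀ p q : Additive P, (∀ n, p.toMul.1 n = q.toMul.1 n) → p = q := by
    intro p q h
    apply Additive.toMul.injective
    apply Subtype.ext
    ext n
    exact h n
  have hPadd : ∀ (p q : Additive P) (n : ℤ), (p + q).toMul.1 n = p.toMul.1 (q.toMul.1 n) :=
    fun p q n => rfl
  have hPneg : ∀ (p : Additive P) (n : ℤ), (-p).toMul.1 (p.toMul.1 n) = n := by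
    intro p n
    rw [← hPadd, neg_add_cancel]; rfl
  let φ : Additive P → ℤ := fun p => p.toMul.1 0
  have hφT : ∀ p q : Additive P, φ (p + T (φ p) q) = φ p + φ q := by
    intro p q
    rw [add_comm]
    change (T (φ p) q + p).toMul.1 0 = _
    rw [hPadd, hTa]
    change _ + q.toMul.1 (-φ p + φ p) = _
    rw [neg_add_cancel]
  have hsurj : Function.Surjective φ := by
    let H : AddSubgroup ℤ :=
      { carrier := Set.range φ
        zero_mem' := ⟨0, rfl⟩
        add_mem' := by
          rintro _ _ ⟨p, rfl⟩ ⟨q, rfl⟩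
          exact ⟨_, hφT p q⟩
        neg_mem' := by
          rintro _ ⟨p, rfl⟩
          refine ⟨T (-φ p) (-p), ?_⟩
          change (T (-φ p) (-p)).toMul.1 0 = _
          rw [hTa, neg_neg, add_zero]
          change _ + (-p).toMul.1 (p.toMul.1 0) = _
          rw [hPneg, add_zero] }
    have : AddSubgroup.closure (Set.range f) ≤ H := by
      refine (AddSubgroup.closure_le _).2 ?_
      rintro _ ⟨x, rfl⟩
      refine ⟨Additive.ofMul ⟨π x, Subgroup.subset_closure ⟨x, rfl⟩⟩, ?_⟩
      change π x 0 = _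
      rw [hπ]; simp
    rw [hgen] at this
    intro n
    exact this (AddSubgroup.mem_top n)
  have hinj : Function.Injective φ := by
    intro p q h
    apply hextP
    intro n
    obtain ⟨r, rfl⟩ := hsurj n
    change p.toMul.1 (r.toMul.1 0) = q.toMul.1 (r.toMul.1 0)
    rw [← hPadd, ← hPadd, add_comm p, add_comm q, hPadd, hPadd]
    exact congrArg _ h
  let e := Equiv.ofBijective φ ⟨hinj, hsurj⟩
  have hφe : ∀ n, φ (e.symm n) = n := fun n => e.apply_symm_apply n
  have hT1 : T 1 = 1 := by
    refine moduleLemma T ?_ ?_ e.symm e.symm.bijective ?_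
    · ext p : 1
      apply hextP
      intro n
      rw [hTa]
      simp
    · intro m n
      ext p : 1
      apply hextP
      intro k
      change _ = (T m (T n p)).toMul.1 k
      rw [hTa, hTa, hTa, neg_add_rev, add_assoc, add_assoc]
    · intro m n
      apply hinj
      have := hφT (e.symm m) (e.symm n)
      rw [hφe, hφe] at this
      rw [hφe, this]
  intro x
  have h1 := DFunLike.congr_fun hT1
    (Additive.ofMul ⟨π (x + 1), Subgroup.subset_closure ⟨x + 1, rfl⟩⟩ : Additive P)
  have h2 := congrArg (fun p : Additive P => p.toMul.1 0) h1
  simp only [hTa] at h2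
  change 1 + π (x + 1) (-1 + 0) = π (x + 1) 0 at h2
  rw [hπ, hπ] at h2
  simp at h2
  exact h2.symm

/-- An infinite indecomposable cycle set with permutation group
isomorphic to `(ℤ,+)` is isomorphic to the cycle set on `ℤ` with `a · b = b + 1`. -/
theorem stmt2 {X : Type} [Infinite X] (C : CycleSet X)
    (hind : C.Indecomposable) (hG : Nonempty (C.G ≃* Multiplicative ℤ)) :
    ∃ (D : CycleSet ℤ) (f : X ≃ ℤ),
      (∀ a b : ℤ, D.mul a b = b + 1) ∧
      ∀ a b, f (C.mul a b) = D.mul (f a) (f b) := by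
  obtain ⟨Φ⟩ := hG
  let γ : ℤ → Equiv.Perm X := fun n => (Φ.symm (Multiplicative.ofAdd n)).1
  have hγG : ∀ n, γ n ∈ C.G := fun n => (Φ.symm (Multiplicative.ofAdd n)).2
  have hγadd : ∀ m n, γ (m + n) = γ m * γ n := by
    intro m n
    simp only [γ, ofAdd_add, map_mul, Subgroup.coe_mul]
  have hγ0 : γ 0 = 1 := by
    simp only [γ, ofAdd_zero, map_one, Subgroup.coe_one]
  have hγsurj : ∀ g ∈ C.G, ∃ n, γ n = g := by
    intro g hg
    exact ⟨(Φ ⟨g, hg⟩).toAdd, by simp [γ]⟩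
  have hγinj : Function.Injective γ := by
    intro m n h
    have := Φ.symm.injective (Subtype.ext h)
    exact Multiplicative.ofAdd.injective this
  obtain ⟨x0⟩ : Nonempty X := inferInstance
  have hbij : Function.Bijective (fun n => γ n x0) := by
    constructor
    · intro m n h
      apply hγinj
      ext y
      obtain ⟨g, hg, rfl⟩ := hind x0 y
      obtain ⟨k, rfl⟩ := hγsurj g hg
      rw [← Equiv.Perm.mul_apply, ← Equiv.Perm.mul_apply, ← hγadd, ← hγadd, add_comm m,
        add_comm n, hγadd, hγadd]
      exact congrArg (γ k) h
    · intro y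
      obtain ⟨g, hg, rfl⟩ := hind x0 y
      obtain ⟨k, rfl⟩ := hγsurj g hg
      exact ⟨k, rfl⟩
  let e : ℤ ≃ X := Equiv.ofBijective _ hbij
  have he : ∀ n, e n = γ n x0 := fun n => rfl
  have hsG : ∀ x, C.sigma x ∈ C.G := fun x => Subgroup.subset_closure ⟨x, rfl⟩
  choose F hF using fun x => hγsurj _ (hsG x)
  let f : ℤ → ℤ := fun n => F (e n)
  have hmul : ∀ a b, C.mul (e a) (e b) = e (b + f a) := by
    intro a b
    change C.sigma (e a) (e b) = _
    rw [← hF, he b, he, ← Equiv.Perm.mul_apply, ← hγadd, add_comm]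
    rfl
  have hconst : ∀ x, f (x + 1) = f x := by
    refine coreLemma f ?_ ?_ ?_
    · intro x y
      have := C.cycloid (e x) (e y) (e 0)
      simp only [hmul] at this
      have := e.injective this
      linarith
    · have : (fun x => x + f x) = e.symm ∘ (fun x => C.mul x x) ∘ e := by
        funext x
        simp [hmul]
      rw [this]
      exact e.symm.bijective.comp (C.nondeg.comp e.bijective)
    · rw [eq_top_iff]
      intro n _
      have hcl : ∀ g ∈ C.G, ∃ n ∈ AddSubgroup.closure (Set.range f), γ n = g := by
        intro g hg
        induction hg using Subgroup.closure_induction with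
        | mem g hg =>
          obtain ⟨x, rfl⟩ := hg
          exact ⟨F x, AddSubgroup.subset_closure ⟨e.symm x, by simp [f]⟩, hF x⟩
        | one => exact ⟨0, zero_mem _, hγ0⟩
        | mul g h _ _ ih1 ih2 =>
          obtain ⟨m, hm, rfl⟩ := ih1
          obtain ⟨k, hk, rfl⟩ := ih2
          exact ⟨m + k, add_mem hm hk, hγadd _ _⟩
        | inv g _ ih =>
          obtain ⟨m, hm, rfl⟩ := ih
          refine ⟨-m, neg_mem hm, ?_⟩
          rw [eq_inv_iff_mul_eq_one, ← hγadd, neg_add_cancel, hγ0]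
      obtain ⟨m, hm, h⟩ := hcl _ (hγG n)
      rwa [← hγinj h]
  have hc : ∀ x, f x = f 0 := by
    intro x
    induction x using Int.induction_on with
    | zero => rfl
    | succ i ih => rw [hconst, ih]
    | pred i ih => rw [← ih, ← hconst (-(i : ℤ) - 1), sub_add_cancel]
  have hunit : f 0 = 1 ∨ f 0 = -1 := by
    have hcl : ∀ g ∈ C.G, ∃ n, γ (f 0 * n) = g := by
      intro g hg
      induction hg using Subgroup.closure_induction with
      | mem g hg =>
        obtain ⟨x, rfl⟩ := hg
        refine ⟨1, ?_⟩
        rw [mul_one, ← hc (e.symm x), ← hF x]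
        simp [f]
      | one => exact ⟨0, by rw [mul_zero, hγ0]⟩
      | mul g h _ _ ih1 ih2 =>
        obtain ⟨m, rfl⟩ := ih1
        obtain ⟨k, rfl⟩ := ih2
        exact ⟨m + k, by rw [mul_add, hγadd]⟩
      | inv g _ ih =>
        obtain ⟨m, rfl⟩ := ih
        refine ⟨-m, ?_⟩
        rw [eq_inv_iff_mul_eq_one, ← hγadd, mul_neg, neg_add_cancel, hγ0]
    obtain ⟨n, hn⟩ := hcl _ (hγG 1)
    exact Int.isUnit_iff.1 (IsUnit.of_mul_eq_one n (hγinj hn))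
  refine ⟨⟨fun _ b => b + 1, fun _ => (Equiv.addRight (1 : ℤ)).bijective, fun _ _ _ => rfl,
    (Equiv.addRight (1 : ℤ)).bijective⟩, ?_⟩
  have hmul' : ∀ a b, C.mul a b = e (e.symm b + f 0) := by
    intro a b
    rw [← hc (e.symm a), ← hmul]
    simp
  rcases hunit with h | h
  · refine ⟨e.symm, fun _ _ => rfl, fun a b => ?_⟩
    rw [hmul', h]
    simp
  · refine ⟨e.symm.trans (Equiv.neg ℤ), fun _ _ => rfl, fun a b => ?_⟩
    rw [hmul', h]
    simp
    try ring
end
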